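/- (Main theorem, sufficiency, dyadic case; Lemma 3.2) Let 0 ≤ α < 2n, 1 < p₁,p₂ < ∞, 1/p = 1/p₁ + 1/p₂, 1/q = 1/p − α/n, and q ≥ max{p₁,p₂}. Let w₁, w₂, v be weights, σ_i = w_i^{1-p_i'}. If the Sawyer testing constant [w⃗,v]_S = sup_Q (∫_Q ℳ_α(σ₁1_Q, σ₂1_Q)^q v dx)^{1/q}/(σ₁(Q)^{1/p₁}σ₂(Q)^{1/p₂}) is finite, then for any dyadic grid 𝒟, ‖ℳ^𝒟_α(f₁σ₁, f₂σ₂)‖_{L^q(v)} ≤ C [w⃗,v]_S ‖f₁‖_{L^{p₁}(σ₁)} ‖f₂‖_{L^{p₂}(σ₂)} for all f₁, f₂. -/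

import Mathlib

open MeasureTheory ENNReal Set
open scoped BigOperators

noncomputable section

abbrev Rn (n : ℕ) := Fin n → ℝ

/-- An axis-parallel half-open cube with corner `c` and side length `l`. -/
def cube {n : ℕ} (c : Rn n) (l : ℝ) : Set (Rn n) :=
  {x | ∀ i, c i ≤ x i ∧ x i < c i + l}

/-- `σ(Q) = ∫_Q σ dx`. -/
def wtI {n : ℕ} (σ : Rn n → ℝ≥0∞) (Q : Set (Rn n)) : ℝ≥0∞ := ∫⁻ x in Q, σ x

/-- `𝔼^σ_Q f = σ(Q)⁻¹ ∫_Q f σ`. -/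
def avgE {n : ℕ} (σ f : Rn n → ℝ≥0∞) (Q : Set (Rn n)) : ℝ≥0∞ :=
  (wtI σ Q)⁻¹ * ∫⁻ x in Q, f x * σ x

/-- The cube `2^{-k}([0,1)ⁿ + m + (-1)^k t)` of the shifted dyadic grid. -/
def gridCube (n : ℕ) (k : ℤ) (m : Fin n → ℤ) (t : Fin n → ℝ) : Set (Rn n) :=
  {x | ∀ i, (2:ℝ) ^ (-k) * ((m i : ℝ) + (-1:ℝ) ^ k * t i) ≤ x i ∧
       x i < (2:ℝ) ^ (-k) * ((m i : ℝ) + (-1:ℝ) ^ k * t i + 1)}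

/-- The shifted dyadic grid `𝒟_t`. -/
def shiftedGrid (n : ℕ) (t : Fin n → ℝ) : Set (Set (Rn n)) :=
  {Q | ∃ (k : ℤ) (m : Fin n → ℤ), Q = gridCube n k m t}

/-- Abstract dyadic grid: cubes of dyadic side lengths, nested or disjoint,
and for each scale the cubes of that side length cover `ℝⁿ`. -/
def IsDyadicGrid {n : ℕ} (𝒟 : Set (Set (Rn n))) : Prop :=
  (∀ Q ∈ 𝒟, ∃ (c : Rn n) (k : ℤ), Q = cube c ((2:ℝ) ^ k)) ∧
  (∀ Q ∈ 𝒟, ∀ R ∈ 𝒟, Q ∩ R = Q ∨ Q ∩ R = R ∨ Q ∩ R = ∅) ∧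
  (∀ k : ℤ, (⋃ Q ∈ {Q | Q ∈ 𝒟 ∧ ∃ c : Rn n, Q = cube c ((2:ℝ) ^ k)}, Q) = univ)

/-- The multilinear fractional maximal operator `ℳ_α`. -/
def MM (n m : ℕ) (α : ℝ) (g : Fin m → Rn n → ℝ≥0∞) (x : Rn n) : ℝ≥0∞ :=
  ⨆ (c : Rn n) (l : ℝ) (_ : 0 < l) (_ : x ∈ cube c l),
    ∏ i, (volume (cube c l) ^ (-(1 - α / ((m : ℝ) * (n : ℝ)))) * ∫⁻ y in cube c l, g i y)

/-- The multilinear fractional maximal operator restricted to a grid `𝒟`. -/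
def MMD (n m : ℕ) (α : ℝ) (𝒟 : Set (Set (Rn n))) (g : Fin m → Rn n → ℝ≥0∞)
    (x : Rn n) : ℝ≥0∞ :=
  ⨆ (Q : Set (Rn n)) (_ : Q ∈ 𝒟) (_ : x ∈ Q),
    ∏ i, (volume Q ^ (-(1 - α / ((m : ℝ) * (n : ℝ)))) * ∫⁻ y in Q, g i y)

/-- The bilinear fractional maximal operator `ℳ_α(g₁,g₂)`. -/
def M2 (n : ℕ) (α : ℝ) (g₁ g₂ : Rn n → ℝ≥0∞) (x : Rn n) : ℝ≥0∞ :=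
  ⨆ (c : Rn n) (l : ℝ) (_ : 0 < l) (_ : x ∈ cube c l),
    (volume (cube c l) ^ (-(1 - α / (2 * (n : ℝ)))) * ∫⁻ y in cube c l, g₁ y) *
      (volume (cube c l) ^ (-(1 - α / (2 * (n : ℝ)))) * ∫⁻ y in cube c l, g₂ y)

/-- The bilinear dyadic fractional maximal operator `ℳ^𝒟_α(g₁,g₂)`. -/
def M2D (n : ℕ) (α : ℝ) (𝒟 : Set (Set (Rn n))) (g₁ g₂ : Rn n → ℝ≥0∞) (x : Rn n) : ℝ≥0∞ :=
  ⨆ (Q : Set (Rn n)) (_ : Q ∈ 𝒟) (_ : x ∈ Q),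
    (volume Q ^ (-(1 - α / (2 * (n : ℝ)))) * ∫⁻ y in Q, g₁ y) *
      (volume Q ^ (-(1 - α / (2 * (n : ℝ)))) * ∫⁻ y in Q, g₂ y)

/-- Sawyer's bilinear testing constant `[w⃗,v]_{S_{P⃗,q}}`. -/
def sawyer2 (n : ℕ) (α p₁ p₂ q : ℝ) (σ₁ σ₂ v : Rn n → ℝ≥0∞) : ℝ≥0∞ :=
  ⨆ (c : Rn n) (l : ℝ) (_ : 0 < l),
    (∫⁻ x in cube c l,
        M2 n α ((cube c l).indicator σ₁) ((cube c l).indicator σ₂) x ^ q * v x) ^ (1/q) /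
      (wtI σ₁ (cube c l) ^ (1/p₁) * wtI σ₂ (cube c l) ^ (1/p₂))

/-- Sawyer's multilinear testing constant. -/
def sawyerM (n m : ℕ) (α q : ℝ) (p : Fin m → ℝ) (σ : Fin m → Rn n → ℝ≥0∞)
    (v : Rn n → ℝ≥0∞) : ℝ≥0∞ :=
  ⨆ (c : Rn n) (l : ℝ) (_ : 0 < l),
    (∫⁻ x in cube c l, MM n m α (fun i => (cube c l).indicator (σ i)) x ^ q * v x) ^ (1/q) /
      ∏ i, wtI (σ i) (cube c l) ^ (1 / p i)

/-- The principal cubes of `f` relative to `σ` inside `Qbar`, generation by generation. -/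
def principalCubes {n : ℕ} (𝒟 : Set (Set (Rn n))) (σ f : Rn n → ℝ≥0∞)
    (Qbar : Set (Rn n)) : ℕ → Set (Set (Rn n))
  | 0 => {Qbar}
  | k + 1 => {G' | G' ∈ 𝒟 ∧ ∃ G ∈ principalCubes 𝒟 σ f Qbar k, G' ⊆ G ∧
      4 * avgE σ f G < avgE σ f G' ∧
      ∀ G'' ∈ 𝒟, G' ⊆ G'' → G'' ⊆ G → 4 * avgE σ f G < avgE σ f G'' → G'' = G'}

lemma rpow_tsum_le {ι : Type*} (a : ι → ℝ≥0∞) {r : ℝ} (hr : 1 ≤ r) :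
    ∑' i, a i ^ r ≤ (∑' i, a i) ^ r := by
  have key : ∀ x : ℝ≥0∞, x ^ r = x * x ^ (r - 1) := by
    intro x
    have := ENNReal.rpow_add_of_nonneg (x := x) 1 (r - 1) (by norm_num) (by linarith)
    rw [ENNReal.rpow_one] at this
    rw [← this]; congr 1; ring
  rw [key (∑' i, a i), ← ENNReal.tsum_mul_right]
  refine ENNReal.tsum_le_tsum fun i => ?_
  rw [key (a i)]
  exact mul_le_mul_right (ENNReal.rpow_le_rpow (ENNReal.le_tsum i) (by linarith)) _

/-- powers of two in `ℝ≥0∞` -/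
def dd (k : ℤ) : ℝ≥0∞ := (2 : ℝ≥0∞) ^ (k : ℝ)

lemma dd_ne_zero (k : ℤ) : dd k ≠ 0 := by
  unfold dd
  exact (ENNReal.rpow_pos (by norm_num) (by norm_num)).ne'

lemma dd_ne_top (k : ℤ) : dd k ≠ ∞ := by
  unfold dd
  rw [ne_eq, ENNReal.rpow_eq_top_iff]
  simp

lemma dd_add (k l : ℤ) : dd (k + l) = dd k * dd l := by
  simp only [dd]; push_cast
  rw [ENNReal.rpow_add _ _ (by norm_num) (by norm_num)]

lemma dd_one : dd 1 = 2 := by simp [dd]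
lemma dd_zero : dd 0 = 1 := by simp [dd]

lemma dd_lt {k l : ℤ} (h : dd k < dd l) : k < l := by
  by_contra hh
  push Not at hh
  refine absurd h (not_lt.2 ?_)
  apply ENNReal.rpow_le_rpow_of_exponent_le (by norm_num)
  exact_mod_cast hh

lemma exists_dd {y : ℝ≥0∞} (h0 : y ≠ 0) (ht : y ≠ ∞) : ∃ k, dd k ≤ y ∧ y < dd (k+1) := by
  obtain ⟨k, hk⟩ := ENNReal.exists_mem_Ico_zpow h0 ht (y := 2) (by norm_num) (by norm_num)
  refine ⟨k, ?_, ?_⟩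
  · simpa [dd, ENNReal.rpow_intCast] using hk.1
  · simp only [dd, ENNReal.rpow_intCast]; exact hk.2

lemma exists_dd' {y : ℝ≥0∞} (h0 : y ≠ 0) (ht : y ≠ ∞) : ∃ k, dd k < y ∧ y ≤ dd (k+1) := by
  obtain ⟨k, hk⟩ := ENNReal.exists_mem_Ioc_zpow h0 ht (y := 2) (by norm_num) (by norm_num)
  refine ⟨k, ?_, ?_⟩
  · simpa [dd, ENNReal.rpow_intCast] using hk.1
  · simp only [dd, ENNReal.rpow_intCast]; exact hk.2

def Cg (s : ℝ) : ℝ≥0∞ := 2 ^ s * (1 - (2 : ℝ≥0∞) ^ (-s))⁻¹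

lemma Cg_ne_top {s : ℝ} (hs : 0 < s) : Cg s ≠ ∞ := by
  unfold Cg
  refine ENNReal.mul_ne_top (ENNReal.rpow_ne_top_of_nonneg hs.le (by norm_num)) ?_
  rw [ENNReal.inv_ne_top]
  apply (tsub_pos_of_lt ?_).ne'
  exact ENNReal.rpow_lt_one_of_one_lt_of_neg (by norm_num) (by linarith)

lemma Cg_ne_zero (s : ℝ) : Cg s ≠ 0 := by
  unfold Cg
  refine mul_ne_zero ?_ ?_
  · simp [ENNReal.rpow_eq_zero_iff]
  · rw [ENNReal.inv_ne_zero]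
    exact (lt_of_le_of_lt tsub_le_self (by norm_num)).ne

lemma geom_bound {s : ℝ} (hs : 0 < s) (y : ℝ≥0∞) :
    ∑' k : ℤ, (if dd (k - 1) < y then (dd k) ^ s else 0) ≤ Cg s * y ^ s := by
  classical
  by_cases h0 : y = 0
  · simp [h0]
  by_cases ht : y = ∞
  · rw [ht, ENNReal.top_rpow_of_pos hs, ENNReal.mul_top (Cg_ne_zero s)]; exact le_top
  obtain ⟨j, hj1, hj2⟩ := exists_dd h0 ht
  have h1 : ∑' k : ℤ, (if dd (k - 1) < y then (dd k) ^ s else 0) ≤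
      ∑' k : ℤ, (if k ≤ j + 1 then (dd k) ^ s else 0) := by
    refine ENNReal.tsum_le_tsum fun k => ?_
    by_cases hk : dd (k-1) < y
    · have := dd_lt (hk.trans hj2)
      rw [if_pos hk, if_pos (by lia)]
    · rw [if_neg hk]; exact bot_le
  refine h1.trans ?_
  have hinj : Function.Injective (fun i : ℕ => j + 1 - (i : ℤ)) := by
    intro a b h; simp only at h; lia
  rw [← hinj.tsum_eq]
  · have : ∀ i : ℕ, (if j + 1 - (i:ℤ) ≤ j + 1 then (dd (j + 1 - (i:ℤ))) ^ s else 0)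
        = (dd j) ^ s * 2 ^ s * ((2 : ℝ≥0∞) ^ (-s)) ^ i := by
      intro i
      rw [if_pos (by lia), ← ENNReal.rpow_natCast, ← ENNReal.rpow_mul]
      simp only [dd]
      rw [← ENNReal.rpow_mul, ← ENNReal.rpow_mul, ← ENNReal.rpow_add _ _ (by norm_num) (by norm_num),
        ← ENNReal.rpow_add _ _ (by norm_num) (by norm_num)]
      congr 1; push_cast; ring
    simp only [this]
    rw [ENNReal.tsum_mul_left, ENNReal.tsum_geometric, Cg, mul_comm (dd j ^ s), mul_assoc, mul_assoc, mul_comm (dd j ^ s), ]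
    gcongr
  · intro k hk
    simp only [Function.mem_support, ne_eq, ite_eq_right_iff, Classical.not_imp] at hk
    exact ⟨(j + 1 - k).toNat, by simp only; lia⟩

section Core

variable {X : Type*} [MeasurableSpace X]

/-- stopping cubes at level `2^k` -/
def Stop (F : Finset (Set X)) (ν : Measure X) (f : X → ℝ≥0∞) (k : ℤ) (G : Set X) : Prop :=
  dd k * ν G < ∫⁻ x in G, f x ∂ν ∧
    ∀ R ∈ F, G ⊆ R → dd k * ν R < ∫⁻ x in R, f x ∂ν → R = G

def Nested (F : Finset (Set X)) : Prop :=
  ∀ Q ∈ F, ∀ R ∈ F, Q ⊆ R ∨ R ⊆ Q ∨ Disjoint Q R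

lemma exists_stop (F : Finset (Set X)) (ν : Measure X) (f : X → ℝ≥0∞) (k : ℤ) (Q : Set X)
    (hQ : Q ∈ F) (h : dd k * ν Q < ∫⁻ x in Q, f x ∂ν) : ∃ G ∈ F, Q ⊆ G ∧ Stop F ν f k G := by
  classical
  obtain ⟨G, hG, hmax⟩ := (F.filter
    (fun R => Q ⊆ R ∧ dd k * ν R < ∫⁻ x in R, f x ∂ν)).exists_le_maximal
    (a := Q) (by simp [hQ, h])
  have hm := hmax.prop
  simp only [Finset.mem_filter] at hm
  refine ⟨G, hm.1, hm.2.1, hm.2.2, fun R hR hGR hlt => ?_⟩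
  have : R ≤ G := hmax.le_of_ge (by simp [hR, hlt, hm.2.1.trans hGR]) hGR
  exact Subset.antisymm this hGR

lemma stop_disj (F : Finset (Set X)) (hF : Nested F) (ν : Measure X) (f : X → ℝ≥0∞) (k : ℤ)
    {G G' : Set X} (hG : G ∈ F) (hG' : G' ∈ F) (h : Stop F ν f k G) (h' : Stop F ν f k G')
    (hne : G ≠ G') : Disjoint G G' := by
  rcases hF G hG G' hG' with h1 | h1 | h1
  · exact absurd (h.2 G' hG' h1 h'.1).symm hne
  · exact absurd (h'.2 G hG h1 h.1) hne
  · exact h1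

open Classical in
lemma stop_level (F : Finset (Set X)) (hF : Nested F) (hm : ∀ Q ∈ F, MeasurableSet Q)
    (ν : Measure X) (hfin : ∀ Q ∈ F, ν Q ≠ ∞) (f : X → ℝ≥0∞) (hf : Measurable f) (k : ℤ) :
    ∑ G ∈ F, (if Stop F ν f k G then ν G else 0) ≤
      dd (1 - k) * ∫⁻ x, (if dd (k-1) < f x then f x else 0) ∂ν := by
  set g : X → ℝ≥0∞ := fun x => if dd (k-1) < f x then f x else 0 with hg
  have hgm : Measurable g := Measurable.ite (measurableSet_lt measurable_const hf) hf measurable_const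
  rw [← Finset.sum_filter]
  have h1 : ∀ G ∈ F.filter (fun G => Stop F ν f k G), ν G ≤ dd (1-k) * ∫⁻ x in G, g x ∂ν := by
    intro G hG
    rw [Finset.mem_filter] at hG
    have hlt := hG.2.1
    have hle : ∫⁻ x in G, f x ∂ν ≤ (∫⁻ x in G, g x ∂ν) + dd (k-1) * ν G := by
      rw [← setLIntegral_const, ← lintegral_add_left hgm]
      refine lintegral_mono fun x => ?_
      by_cases hx : dd (k-1) < f x
      · simp [hg, hx]
      · simp [hg, hx]; exact not_lt.1 hx
    have h2 : dd k * ν G = dd (k-1) * ν G + dd (k-1) * ν G := by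
      have : dd k = dd (k-1) * 2 := by rw [← dd_one, ← dd_add]; congr 1; ring
      rw [this]; ring
    rw [h2] at hlt
    have hft : dd (k-1) * ν G ≠ ∞ := ENNReal.mul_ne_top (dd_ne_top _) (hfin G hG.1)
    have h3 : dd (k-1) * ν G ≤ ∫⁻ x in G, g x ∂ν :=
      (ENNReal.add_le_add_iff_right hft).1 (hlt.le.trans hle)
    calc ν G = dd (1-k) * (dd (k-1) * ν G) := by
          rw [← mul_assoc, ← dd_add]; simp [dd_zero]
      _ ≤ _ := by gcongr
  refine (Finset.sum_le_sum h1).trans ?_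
  rw [← Finset.mul_sum]
  gcongr
  rw [← lintegral_biUnion_finset]
  · exact setLIntegral_le_lintegral _ _
  · intro G hG G' hG' hne
    simp only [Finset.coe_filter, mem_ofPred_eq] at hG hG'
    exact stop_disj F hF ν f k hG.1 hG'.1 hG.2 hG'.2 hne
  · intro G hG; exact hm G (Finset.mem_filter.1 hG).1

open Classical in
lemma stop_sum (F : Finset (Set X)) (hF : Nested F) (hm : ∀ Q ∈ F, MeasurableSet Q)
    (ν : Measure X) (hfin : ∀ Q ∈ F, ν Q ≠ ∞) (f : X → ℝ≥0∞) (hf : Measurable f)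
    {p : ℝ} (hp : 1 < p) :
    ∑' k : ℤ, ∑ G ∈ F, (if Stop F ν f k G then dd k ^ p * ν G else 0) ≤
      2 * Cg (p - 1) * ∫⁻ x, f x ^ p ∂ν := by
  have key : ∀ x : ℝ≥0∞, x ^ p = x * x ^ (p - 1) := by
    intro x
    have := ENNReal.rpow_add_of_nonneg (x := x) 1 (p - 1) (by norm_num) (by linarith)
    rw [ENNReal.rpow_one] at this
    rw [← this]; congr 1; ring
  have h1 : ∀ k : ℤ, ∑ G ∈ F, (if Stop F ν f k G then dd k ^ p * ν G else 0) ≤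
      ∫⁻ x, 2 * f x * (if dd (k-1) < f x then (dd k) ^ (p-1) else 0) ∂ν := by
    intro k
    calc ∑ G ∈ F, (if Stop F ν f k G then dd k ^ p * ν G else 0)
        = dd k ^ p * ∑ G ∈ F, (if Stop F ν f k G then ν G else 0) := by
          rw [Finset.mul_sum]; refine Finset.sum_congr rfl fun G _ => ?_
          split_ifs <;> simp
      _ ≤ dd k ^ p * (dd (1 - k) * ∫⁻ x, (if dd (k-1) < f x then f x else 0) ∂ν) := by
          gcongr; exact stop_level F hF hm ν hfin f hf k
      _ = 2 * dd k ^ (p-1) * ∫⁻ x, (if dd (k-1) < f x then f x else 0) ∂ν := by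
          rw [← mul_assoc, key]
          congr 1
          have : dd k * dd (1-k) = 2 := by rw [← dd_add, ← dd_one]; congr 1; ring
          rw [← this]; ring
      _ = _ := by
          rw [← lintegral_const_mul _
            (Measurable.ite (measurableSet_lt measurable_const hf) hf measurable_const)]
          refine lintegral_congr fun x => ?_
          split_ifs
          · ring
          · simp
  refine (ENNReal.tsum_le_tsum h1).trans ?_
  rw [← lintegral_tsum, ← lintegral_const_mul _ (hf.pow_const p)]
  · refine lintegral_mono fun x => ?_
    rw [ENNReal.tsum_mul_left, key]
    calc _ ≤ 2 * f x * (Cg (p-1) * f x ^ (p-1)) := by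
          gcongr; exact geom_bound (by linarith) _
      _ = _ := by ring
  · intro k
    exact ((measurable_const.mul hf).mul (Measurable.ite (measurableSet_lt measurable_const hf) measurable_const measurable_const)).aemeasurable

/-- localized linear maximal function of the coefficients `m` -/
def MG (F : Finset (Set X)) (m : Set X → ℝ≥0∞) (G : Set X) (x : X) : ℝ≥0∞ :=
  ⨆ Q ∈ F, ⨆ (_ : Q ⊆ G), Q.indicator (fun _ => m Q) x

lemma MG_meas (F : Finset (Set X)) (hm : ∀ Q ∈ F, MeasurableSet Q) (m : Set X → ℝ≥0∞)
    (G : Set X) : Measurable (MG F m G) := by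
  unfold MG
  refine Measurable.biSup (F : Set (Set X)) F.countable_toSet
    (f := fun Q x => ⨆ (_ : Q ⊆ G), Q.indicator (fun _ => m Q) x) ?_
  intro Q hQ
  exact Measurable.iSup_Prop _ (measurable_const.indicator (hm Q hQ))

lemma le_MG (F : Finset (Set X)) (m : Set X → ℝ≥0∞) {G Q : Set X} (hQ : Q ∈ F) (h : Q ⊆ G)
    {x : X} (hx : x ∈ Q) : m Q ≤ MG F m G x := by
  unfold MG
  refine le_iSup₂_of_le Q hQ (le_iSup_of_le h ?_)
  simp [hx]

open Classical in
/-- the dominating sum -/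
def HH (F : Finset (Set X)) (m : Set X → ℝ≥0∞) (ν₁ ν₂ : Measure X) (f : X → ℝ≥0∞)
    (N : ℝ≥0∞) (p₁ q : ℝ) (x : X) : ℝ≥0∞ :=
  ∑' k : ℤ, ∑ G ∈ F, (if Stop F ν₂ f k G then
    G.indicator (fun x => (4 * dd k * (N * ν₁ G ^ (-(1/p₁))) * MG F m G x) ^ q) x else 0)

lemma HH_meas (F : Finset (Set X)) (hm : ∀ Q ∈ F, MeasurableSet Q) (m : Set X → ℝ≥0∞)
    (ν₁ ν₂ : Measure X) (f : X → ℝ≥0∞)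
    (N : ℝ≥0∞) (p₁ q : ℝ) : Measurable (HH F m ν₁ ν₂ f N p₁ q) := by
  classical
  unfold HH
  refine Measurable.tsum fun k => Finset.measurable_fun_sum _ fun G hG => ?_
  split_ifs
  · exact ((measurable_const.mul (MG_meas F hm m G)).pow_const q).indicator (hm G hG)
  · exact measurable_const

lemma rpow_sum_le {ι : Type*} (s : Finset ι) (a : ι → ℝ≥0∞) {r : ℝ} (hr : 1 ≤ r) :
    ∑ i ∈ s, a i ^ r ≤ (∑ i ∈ s, a i) ^ r := by
  have := rpow_tsum_le (fun i : s => a i) hr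
  rwa [Finset.tsum_subtype s (fun i => a i ^ r), Finset.tsum_subtype s a] at this

lemma HH_int (F : Finset (Set X)) (hF : Nested F) (hm : ∀ Q ∈ F, MeasurableSet Q)
    (m : Set X → ℝ≥0∞) (μ ν₁ ν₂ : Measure X) (hfin₁ : ∀ Q ∈ F, ν₁ Q ≠ ∞)
    (hfin₂ : ∀ Q ∈ F, ν₂ Q ≠ ∞) (f : X → ℝ≥0∞)
    (hf : Measurable f) (N S : ℝ≥0∞) {p₁ p₂ q : ℝ} (hp₁ : 1 < p₁) (hp₂ : 1 < p₂) (hq : p₂ ≤ q)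
    (test : ∀ G ∈ F, ∫⁻ x in G, MG F m G x ^ q ∂μ ≤ (S * (ν₁ G ^ (1/p₁) * ν₂ G ^ (1/p₂))) ^ q) :
    ∫⁻ x, HH F m ν₁ ν₂ f N p₁ q x ∂μ ≤
      (4 * S * N * (2 * Cg (p₂ - 1) * ∫⁻ x, f x ^ p₂ ∂ν₂) ^ (1/p₂)) ^ q := by
  classical
  have hq0 : 0 ≤ q := by linarith
  have hr : 1 ≤ q / p₂ := by rw [le_div_iff₀ (by linarith)]; linarith
  have hterm : ∀ k : ℤ, ∀ G ∈ F, ∫⁻ x, (if Stop F ν₂ f k G then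
      G.indicator (fun x => (4 * dd k * (N * ν₁ G ^ (-(1/p₁))) * MG F m G x) ^ q) x else 0) ∂μ
      ≤ (4 * S * N) ^ q * (if Stop F ν₂ f k G then dd k ^ p₂ * ν₂ G else 0) ^ (q / p₂) := by
    intro k G hG
    split_ifs
    · rw [lintegral_indicator (hm G hG)]
      simp only [ENNReal.mul_rpow_of_nonneg _ (MG F m G _) hq0]
      rw [lintegral_const_mul _ ((MG_meas F hm m G).pow_const q)]
      refine (mul_le_mul_right (test G hG) _).trans ?_
      rw [← ENNReal.mul_rpow_of_nonneg _ _ hq0]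
      have e : (dd k ^ p₂ * ν₂ G) ^ (q / p₂) = (dd k * ν₂ G ^ (1/p₂)) ^ q := by
        have : q / p₂ = (1/p₂) * q := by ring
        rw [this, ENNReal.rpow_mul, ENNReal.mul_rpow_of_nonneg _ _ (by positivity),
          ← ENNReal.rpow_mul, mul_one_div_cancel (by positivity), ENNReal.rpow_one]
      rw [e, ← ENNReal.mul_rpow_of_nonneg _ _ hq0]
      refine ENNReal.rpow_le_rpow ?_ hq0
      have h1 : ν₁ G ^ (-(1/p₁)) * ν₁ G ^ (1/p₁) ≤ 1 := by
        rw [ENNReal.rpow_neg]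
        exact ENNReal.inv_mul_le_one _
      calc _ = 4 * S * N * (dd k * ν₂ G ^ (1/p₂)) * (ν₁ G ^ (-(1/p₁)) * ν₁ G ^ (1/p₁)) := by ring
        _ ≤ 4 * S * N * (dd k * ν₂ G ^ (1/p₂)) * 1 := by gcongr
        _ = _ := mul_one _
    · simp
  have hmeas : ∀ k : ℤ, ∀ G ∈ F, Measurable (fun x => (if Stop F ν₂ f k G then
      G.indicator (fun x => (4 * dd k * (N * ν₁ G ^ (-(1/p₁))) * MG F m G x) ^ q) x else 0)) := by
    intro k G hG
    split_ifs
    · exact ((measurable_const.mul (MG_meas F hm m G)).pow_const q).indicator (hm G hG)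
    · exact measurable_const
  unfold HH
  rw [lintegral_tsum fun k => (Finset.measurable_fun_sum _ fun G hG => hmeas k G hG).aemeasurable]
  calc _ ≤ ∑' k : ℤ, (4 * S * N) ^ q *
        (∑ G ∈ F, (if Stop F ν₂ f k G then dd k ^ p₂ * ν₂ G else 0)) ^ (q / p₂) := by
        refine ENNReal.tsum_le_tsum fun k => ?_
        rw [lintegral_finsetSum' _ fun G hG => (hmeas k G hG).aemeasurable]
        refine (Finset.sum_le_sum fun G hG => hterm k G hG).trans ?_
        rw [← Finset.mul_sum]
        exact mul_le_mul_right (rpow_sum_le _ _ hr) _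
    _ ≤ (4 * S * N) ^ q *
        (∑' k : ℤ, ∑ G ∈ F, (if Stop F ν₂ f k G then dd k ^ p₂ * ν₂ G else 0)) ^ (q / p₂) := by
        rw [ENNReal.tsum_mul_left]
        exact mul_le_mul_right (rpow_tsum_le _ hr) _
    _ ≤ (4 * S * N) ^ q * (2 * Cg (p₂ - 1) * ∫⁻ x, f x ^ p₂ ∂ν₂) ^ (q / p₂) := by
        refine mul_le_mul_right (ENNReal.rpow_le_rpow ?_ (by positivity)) _
        exact stop_sum F hF hm ν₂ hfin₂ f hf hp₂
    _ = _ := by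
        rw [ENNReal.mul_rpow_of_nonneg (4 * S * N) ((_ : ℝ≥0∞) ^ (1/p₂)) hq0, ← ENNReal.rpow_mul]
        congr 2; ring

/-- Hölder's inequality for averages -/
lemma avg_le (ν : Measure X) {G : Set X} (h0 : ν G ≠ 0) (ht : ν G ≠ ∞)
    {f : X → ℝ≥0∞} (hf : Measurable f) {p : ℝ} (hp : 1 < p) :
    (ν G)⁻¹ * ∫⁻ x in G, f x ∂ν ≤ (∫⁻ x, f x ^ p ∂ν) ^ (1/p) * ν G ^ (-(1/p)) := by
  have hc : p.HolderConjugate (p / (p-1)) := Real.HolderConjugate.conjExponent hp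
  have h := ENNReal.lintegral_mul_le_Lp_mul_Lq (ν.restrict G) hc hf.aemeasurable
    (g := fun _ => 1) measurable_const.aemeasurable
  simp only [Pi.mul_apply, mul_one, ENNReal.one_rpow, lintegral_const, one_mul,
    Measure.restrict_apply_univ] at h
  calc (ν G)⁻¹ * ∫⁻ x in G, f x ∂ν
      ≤ (ν G)⁻¹ * ((∫⁻ x, f x ^ p ∂ν) ^ (1/p) * ν G ^ (1 / (p / (p-1)))) := by
        refine mul_le_mul_right (h.trans ?_) _
        refine mul_le_mul_left (ENNReal.rpow_le_rpow (setLIntegral_le_lintegral _ _) ?_) _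
        have : 0 < p := by linarith
        positivity
    _ = (∫⁻ x, f x ^ p ∂ν) ^ (1/p) * (ν G ^ (-1 : ℝ) * ν G ^ (1 / (p / (p-1)))) := by
        rw [ENNReal.rpow_neg_one]; ring
    _ = _ := by
        rw [← ENNReal.rpow_add _ _ h0 ht]
        congr 2
        have : p ≠ 0 := by linarith
        have : p - 1 ≠ 0 := by linarith
        field_simp; ring

open Classical in
/-- one-sided pointwise bound -/
lemma one_side (F : Finset (Set X)) (m : Set X → ℝ≥0∞) (ν₁ ν₂ : Measure X)
    (hfin₁ : ∀ Q ∈ F, ν₁ Q ≠ ∞)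
    (f₁ f₂ : X → ℝ≥0∞) (hf₁ : Measurable f₁) {p₁ q : ℝ} (hp₁ : 1 < p₁) (hq : 0 ≤ q)
    {Q G₁ G₂ : Set X} (hQ : Q ∈ F) (hG₁ : G₁ ∈ F) (hG₂ : G₂ ∈ F) (hQ2 : Q ⊆ G₂) (h21 : G₂ ⊆ G₁)
    {k₁ k₂ : ℤ} (hs₁ : Stop F ν₁ f₁ k₁ G₁) (hs₂ : Stop F ν₂ f₂ k₂ G₂)
    {A₁ A₂ : ℝ≥0∞} (hA₁ : A₁ ≤ dd (k₁+1)) (hA₂ : A₂ ≤ dd (k₂+1)) {x : X} (hx : x ∈ Q) :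
    (m Q * (A₁ * A₂)) ^ q ≤
      HH F m ν₁ ν₂ f₂ ((∫⁻ x, f₁ x ^ p₁ ∂ν₁) ^ (1/p₁)) p₁ q x := by
  set N := (∫⁻ x, f₁ x ^ p₁ ∂ν₁) ^ (1/p₁)
  have hG0 : ν₁ G₁ ≠ 0 := by
    intro h
    have := hs₁.1
    rw [h, setLIntegral_measure_zero _ _ h] at this
    simp at this
  have h1 : dd k₁ ≤ (ν₁ G₁)⁻¹ * ∫⁻ x in G₁, f₁ x ∂ν₁ := by
    rw [mul_comm, ← div_eq_mul_inv, ENNReal.le_div_iff_mul_le (Or.inl hG0) (Or.inl (hfin₁ _ hG₁))]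
    exact hs₁.1.le
  have h2 : dd k₁ ≤ N * ν₁ G₂ ^ (-(1/p₁)) := by
    refine (h1.trans (avg_le ν₁ hG0 (hfin₁ _ hG₁) hf₁ hp₁)).trans ?_
    refine mul_le_mul_right ?_ _
    rw [ENNReal.rpow_neg, ENNReal.rpow_neg, ENNReal.inv_le_inv]
    exact ENNReal.rpow_le_rpow (measure_mono h21) (by positivity)
  have h3 : m Q * (A₁ * A₂) ≤ 4 * dd k₂ * (N * ν₁ G₂ ^ (-(1/p₁))) * MG F m G₂ x := by
    calc m Q * (A₁ * A₂) ≤ MG F m G₂ x * ((dd k₁ * 2) * (dd k₂ * 2)) := by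
          rw [dd_add, dd_one] at hA₁ hA₂
          gcongr
          exact le_MG F m hQ hQ2 hx
      _ = 4 * dd k₂ * dd k₁ * MG F m G₂ x := by ring
      _ ≤ _ := by gcongr
  unfold HH
  refine le_trans ?_ (ENNReal.le_tsum k₂)
  refine le_trans ?_ (Finset.single_le_sum (fun _ _ => bot_le) hG₂)
  rw [if_pos hs₂, indicator_of_mem (hQ2 hx)]
  exact ENNReal.rpow_le_rpow h3 hq

def av (ν : Measure X) (f : X → ℝ≥0∞) (Q : Set X) : ℝ≥0∞ := (ν Q)⁻¹ * ∫⁻ x in Q, f x ∂ν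

lemma av_stop (F : Finset (Set X)) (ν : Measure X) (hfin : ∀ Q ∈ F, ν Q ≠ ∞)
    {f : X → ℝ≥0∞} (hf : Measurable f) {p : ℝ} (hp : 1 < p) (hN : ∫⁻ x, f x ^ p ∂ν ≠ ∞)
    {Q : Set X} (hQ : Q ∈ F) (h0 : ν Q ≠ 0) (hA : av ν f Q ≠ 0) :
    ∃ k : ℤ, ∃ G ∈ F, Q ⊆ G ∧ Stop F ν f k G ∧ av ν f Q ≤ dd (k+1) := by
  have ht : av ν f Q ≠ ∞ := by
    refine ne_top_of_le_ne_top ?_ (avg_le ν h0 (hfin Q hQ) hf hp)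
    refine ENNReal.mul_ne_top (ENNReal.rpow_ne_top_of_nonneg (by positivity) hN) ?_
    rw [ENNReal.rpow_neg, ENNReal.inv_ne_top]
    exact (ENNReal.rpow_pos (pos_iff_ne_zero.2 h0) (hfin Q hQ)).ne'
  obtain ⟨k, hk1, hk2⟩ := exists_dd' hA ht
  have : dd k * ν Q < ∫⁻ x in Q, f x ∂ν := by
    unfold av at hk1
    rwa [mul_comm, ← div_eq_mul_inv, ENNReal.lt_div_iff_mul_lt (Or.inl h0) (Or.inl (hfin Q hQ))] at hk1
  obtain ⟨G, hG, hQG, hs⟩ := exists_stop F ν f k Q hQ this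
  exact ⟨k, G, hG, hQG, hs, hk2⟩

def MF (F : Finset (Set X)) (t : Set X → ℝ≥0∞) (x : X) : ℝ≥0∞ :=
  ⨆ Q ∈ F, Q.indicator (fun _ => t Q) x

def Cc (p₁ p₂ q : ℝ) : ℝ≥0∞ :=
  ((4 * (2 * Cg (p₂ - 1)) ^ (1/p₂)) ^ q + (4 * (2 * Cg (p₁ - 1)) ^ (1/p₁)) ^ q) ^ (1/q)

lemma core_fin (F : Finset (Set X)) (hF : Nested F) (hm : ∀ Q ∈ F, MeasurableSet Q)
    (m : Set X → ℝ≥0∞) (μ ν₁ ν₂ : Measure X) (hfin₁ : ∀ Q ∈ F, ν₁ Q ≠ ∞)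
    (hfin₂ : ∀ Q ∈ F, ν₂ Q ≠ ∞) (hm₁ : ∀ Q ∈ F, ν₁ Q = 0 → m Q = 0)
    (hm₂ : ∀ Q ∈ F, ν₂ Q = 0 → m Q = 0)
    (f₁ f₂ : X → ℝ≥0∞) (hf₁ : Measurable f₁) (hf₂ : Measurable f₂)
    (S : ℝ≥0∞) {p₁ p₂ q : ℝ} (hp₁ : 1 < p₁) (hp₂ : 1 < p₂) (hq₁ : p₁ ≤ q) (hq₂ : p₂ ≤ q)
    (test : ∀ G ∈ F, ∫⁻ x in G, MG F m G x ^ q ∂μ ≤ (S * (ν₁ G ^ (1/p₁) * ν₂ G ^ (1/p₂))) ^ q)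
    (hN₁ : ∫⁻ x, f₁ x ^ p₁ ∂ν₁ ≠ ∞) (hN₂ : ∫⁻ x, f₂ x ^ p₂ ∂ν₂ ≠ ∞) :
    (∫⁻ x, MF F (fun Q => m Q * (av ν₁ f₁ Q * av ν₂ f₂ Q)) x ^ q ∂μ) ^ (1/q) ≤
      Cc p₁ p₂ q * S * (∫⁻ x, f₁ x ^ p₁ ∂ν₁) ^ (1/p₁) * (∫⁻ x, f₂ x ^ p₂ ∂ν₂) ^ (1/p₂) := by
  have hq0 : 0 < q := by linarith
  set N₁ := (∫⁻ x, f₁ x ^ p₁ ∂ν₁) ^ (1/p₁) with hN1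
  set N₂ := (∫⁻ x, f₂ x ^ p₂ ∂ν₂) ^ (1/p₂) with hN2
  have hpt : ∀ x, MF F (fun Q => m Q * (av ν₁ f₁ Q * av ν₂ f₂ Q)) x ^ q ≤
      HH F m ν₁ ν₂ f₂ N₁ p₁ q x + HH F m ν₂ ν₁ f₁ N₂ p₂ q x := by
    intro x
    rw [← ENNReal.le_rpow_inv_iff hq0]
    unfold MF
    refine iSup₂_le fun Q hQ => ?_
    rw [ENNReal.le_rpow_inv_iff hq0]
    by_cases hx : x ∈ Q
    swap
    · simp [hx, hq0]
    rw [indicator_of_mem hx]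
    dsimp only
    by_cases hz : m Q * (av ν₁ f₁ Q * av ν₂ f₂ Q) = 0
    · rw [hz, ENNReal.zero_rpow_of_pos hq0]; exact bot_le
    have hmz := left_ne_zero_of_mul hz
    have haz := right_ne_zero_of_mul hz
    obtain ⟨k₁, G₁, hG₁, hQ1, hs₁, hA₁⟩ := av_stop F ν₁ hfin₁ hf₁ hp₁ hN₁ hQ
      (fun h => hmz (hm₁ Q hQ h)) (left_ne_zero_of_mul haz)
    obtain ⟨k₂, G₂, hG₂, hQ2, hs₂, hA₂⟩ := av_stop F ν₂ hfin₂ hf₂ hp₂ hN₂ hQ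
      (fun h => hmz (hm₂ Q hQ h)) (right_ne_zero_of_mul haz)
    rcases hF G₁ hG₁ G₂ hG₂ with h | h | h
    · refine le_trans ?_ le_add_self
      rw [mul_comm (av ν₁ f₁ Q)]
      exact one_side F m ν₂ ν₁ hfin₂ f₂ f₁ hf₂ hp₂ hq0.le hQ hG₂ hG₁ hQ1 h hs₂ hs₁ hA₂ hA₁ hx
    · refine le_trans ?_ le_self_add
      exact one_side F m ν₁ ν₂ hfin₁ f₁ f₂ hf₁ hp₁ hq0.le hQ hG₁ hG₂ hQ2 h hs₁ hs₂ hA₁ hA₂ hx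
    · exact absurd h (Set.not_disjoint_iff.2 ⟨x, hQ1 hx, hQ2 hx⟩)
  have hpow : ∀ C : ℝ≥0∞, ∀ N : ℝ≥0∞, ∀ p : ℝ, 1 < p → (C * N) ^ (1/p) = C ^ (1/p) * N ^ (1/p) :=
    fun C N p hp => ENNReal.mul_rpow_of_nonneg _ _ (by positivity)
  have hI : ∫⁻ x, MF F (fun Q => m Q * (av ν₁ f₁ Q * av ν₂ f₂ Q)) x ^ q ∂μ ≤
      ((4 * (2 * Cg (p₂ - 1)) ^ (1/p₂)) ^ q + (4 * (2 * Cg (p₁ - 1)) ^ (1/p₁)) ^ q) *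
        (S * N₁ * N₂) ^ q := by
    refine (lintegral_mono hpt).trans ?_
    rw [lintegral_add_left (HH_meas F hm _ _ _ _ _ _ _), add_mul]
    refine add_le_add ?_ ?_
    · refine (HH_int F hF hm m μ ν₁ ν₂ hfin₁ hfin₂ f₂ hf₂ N₁ S hp₁ hp₂ hq₂ test).trans ?_
      rw [hpow _ _ _ hp₂, ← hN2, ← ENNReal.mul_rpow_of_nonneg _ _ hq0.le]
      refine le_of_eq ?_
      congr 1; ring
    · refine (HH_int F hF hm m μ ν₂ ν₁ hfin₂ hfin₁ f₁ hf₁ N₂ S hp₂ hp₁ hq₁ ?_).trans ?_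
      · intro G hG
        rw [mul_comm (ν₂ G ^ (1/p₂))]; exact test G hG
      rw [hpow _ _ _ hp₁, ← hN1, ← ENNReal.mul_rpow_of_nonneg _ _ hq0.le]
      refine le_of_eq ?_
      congr 1; ring
  refine (ENNReal.rpow_le_rpow hI (by positivity)).trans ?_
  rw [ENNReal.mul_rpow_of_nonneg _ _ (by positivity), ← ENNReal.rpow_mul (S * N₁ * N₂),
    mul_one_div_cancel hq0.ne', ENNReal.rpow_one, ← Cc]
  refine le_of_eq ?_
  ring

lemma Cc_ne_top {p₁ p₂ q : ℝ} (hp₁ : 1 < p₁) (hp₂ : 1 < p₂) (hq : 0 < q) : Cc p₁ p₂ q ≠ ∞ := by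
  have h : ∀ p : ℝ, 1 < p → (4 * (2 * Cg (p - 1)) ^ (1/p)) ^ q ≠ ∞ := by
    intro p hp
    refine ENNReal.rpow_ne_top_of_nonneg hq.le (ENNReal.mul_ne_top (by norm_num) ?_)
    refine ENNReal.rpow_ne_top_of_nonneg (by positivity) (ENNReal.mul_ne_top (by norm_num) ?_)
    exact Cg_ne_top (by linarith)
  exact ENNReal.rpow_ne_top_of_nonneg (by positivity) (ENNReal.add_ne_top.2 ⟨h _ hp₂, h _ hp₁⟩)

lemma Cc_ne_zero {p₁ p₂ q : ℝ} (hp₂ : 1 < p₂) (hq : 0 < q) : Cc p₁ p₂ q ≠ 0 := by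
  have h : (4 * (2 * Cg (p₂ - 1)) ^ (1/p₂)) ^ q ≠ 0 := by
    have h1 : 0 < 2 * Cg (p₂ - 1) := pos_iff_ne_zero.2 (mul_ne_zero (by norm_num) (Cg_ne_zero _))
    have h2 : 0 < (2 * Cg (p₂ - 1)) ^ (1/p₂) := ENNReal.rpow_pos_of_nonneg h1 (by positivity)
    have h3 : 0 < 4 * (2 * Cg (p₂ - 1)) ^ (1/p₂) :=
      pos_iff_ne_zero.2 (mul_ne_zero (by norm_num) h2.ne')
    exact (ENNReal.rpow_pos_of_nonneg h3 hq.le).ne'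
  refine (ENNReal.rpow_pos_of_nonneg (pos_iff_ne_zero.2 ?_) (by positivity)).ne'
  intro h'
  exact h (add_eq_zero.1 h').1

lemma core_zero (F : Finset (Set X)) (hm : ∀ Q ∈ F, MeasurableSet Q)
    (t : Set X → ℝ≥0∞) (μ : Measure X) {q : ℝ} (hq : 0 < q)
    (h : ∀ Q ∈ F, t Q = 0 ∨ μ Q = 0) : (∫⁻ x, MF F t x ^ q ∂μ) ^ (1/q) = 0 := by
  have : ∫⁻ x, MF F t x ^ q ∂μ ≤ ∑ Q ∈ F, ∫⁻ x, Q.indicator (fun _ => t Q ^ q) x ∂μ := by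
    rw [← lintegral_finsetSum' _ fun Q hQ => (measurable_const.indicator (hm Q hQ)).aemeasurable]
    refine lintegral_mono fun x => ?_
    dsimp only
    rw [← ENNReal.le_rpow_inv_iff hq]
    refine iSup₂_le fun Q hQ => ?_
    rw [ENNReal.le_rpow_inv_iff hq]
    refine le_trans ?_ (Finset.single_le_sum (fun _ _ => bot_le) hQ)
    by_cases hx : x ∈ Q <;> simp [hx, hq]
  have h2 : ∫⁻ x, MF F t x ^ q ∂μ = 0 := by
    refine le_antisymm (this.trans (le_of_eq ?_)) bot_le
    refine Finset.sum_eq_zero fun Q hQ => ?_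
    rw [lintegral_indicator (hm Q hQ), setLIntegral_const]
    rcases h Q hQ with h | h <;> simp [h, hq]
  rw [h2, ENNReal.zero_rpow_of_pos (by positivity)]

lemma av_zero (ν : Measure X) {f : X → ℝ≥0∞} (hf : Measurable f) {p : ℝ} (hp : 1 < p)
    (hN : ∫⁻ x, f x ^ p ∂ν = 0) (Q : Set X) : av ν f Q = 0 := by
  have : f =ᵐ[ν] 0 := by
    have := (lintegral_eq_zero_iff (hf.pow_const p)).1 hN
    filter_upwards [this] with x hx
    have h : f x ^ p = 0 := hx
    rw [ENNReal.rpow_eq_zero_iff] at h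
    rcases h with h | h
    · exact h.1
    · linarith [h.2]
  have h2 : ∫⁻ x in Q, f x ∂ν = 0 := by
    rw [lintegral_congr_ae (ae_restrict_of_ae this)]; simp
  rw [av, h2, mul_zero]

lemma core (F : Finset (Set X)) (hF : Nested F) (hm : ∀ Q ∈ F, MeasurableSet Q)
    (m : Set X → ℝ≥0∞) (μ ν₁ ν₂ : Measure X) (hfin₁ : ∀ Q ∈ F, ν₁ Q ≠ ∞)
    (hfin₂ : ∀ Q ∈ F, ν₂ Q ≠ ∞) (hm₁ : ∀ Q ∈ F, ν₁ Q = 0 → m Q = 0)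
    (hm₂ : ∀ Q ∈ F, ν₂ Q = 0 → m Q = 0)
    (f₁ f₂ : X → ℝ≥0∞) (hf₁ : Measurable f₁) (hf₂ : Measurable f₂)
    (S : ℝ≥0∞) {p₁ p₂ q : ℝ} (hp₁ : 1 < p₁) (hp₂ : 1 < p₂) (hq₁ : p₁ ≤ q) (hq₂ : p₂ ≤ q)
    (test : ∀ G ∈ F, ∫⁻ x in G, MG F m G x ^ q ∂μ ≤ (S * (ν₁ G ^ (1/p₁) * ν₂ G ^ (1/p₂))) ^ q) :
    (∫⁻ x, MF F (fun Q => m Q * (av ν₁ f₁ Q * av ν₂ f₂ Q)) x ^ q ∂μ) ^ (1/q) ≤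
      Cc p₁ p₂ q * S * (∫⁻ x, f₁ x ^ p₁ ∂ν₁) ^ (1/p₁) * (∫⁻ x, f₂ x ^ p₂ ∂ν₂) ^ (1/p₂) := by
  have hq0 : 0 < q := by linarith
  by_cases hS : S = 0
  · refine (core_zero F hm _ μ hq0 fun Q hQ => ?_).le.trans bot_le
    have h1 := test Q hQ
    rw [hS, zero_mul, ENNReal.zero_rpow_of_pos hq0] at h1
    have h2 : m Q ^ q * μ Q ≤ 0 := by
      refine le_trans ?_ h1
      rw [← setLIntegral_const]
      refine setLIntegral_mono' (hm Q hQ) fun x hx => ?_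
      exact ENNReal.rpow_le_rpow (le_MG F m hQ Subset.rfl hx) hq0.le
    rcases mul_eq_zero.1 (le_antisymm h2 bot_le) with h | h
    · left
      rw [(ENNReal.rpow_eq_zero_iff_of_pos hq0).1 h, zero_mul]
    · exact Or.inr h
  by_cases hz₁ : ∫⁻ x, f₁ x ^ p₁ ∂ν₁ = 0
  · refine (core_zero F hm _ μ hq0 fun Q hQ => Or.inl ?_).le.trans bot_le
    simp [av_zero ν₁ hf₁ hp₁ hz₁ Q]
  by_cases hz₂ : ∫⁻ x, f₂ x ^ p₂ ∂ν₂ = 0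
  · refine (core_zero F hm _ μ hq0 fun Q hQ => Or.inl ?_).le.trans bot_le
    simp [av_zero ν₂ hf₂ hp₂ hz₂ Q]
  have hC := Cc_ne_zero (p₁ := p₁) hp₂ hq0
  have e₁ : (∫⁻ x, f₁ x ^ p₁ ∂ν₁) ^ (1/p₁) ≠ 0 :=
    (ENNReal.rpow_pos_of_nonneg (pos_iff_ne_zero.2 hz₁) (by positivity)).ne'
  have e₂ : (∫⁻ x, f₂ x ^ p₂ ∂ν₂) ^ (1/p₂) ≠ 0 :=
    (ENNReal.rpow_pos_of_nonneg (pos_iff_ne_zero.2 hz₂) (by positivity)).ne'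
  by_cases ht₁ : ∫⁻ x, f₁ x ^ p₁ ∂ν₁ = ∞
  · rw [ht₁, ENNReal.top_rpow_of_pos (by positivity), ENNReal.mul_top (mul_ne_zero hC hS),
      ENNReal.top_mul e₂]
    exact le_top
  by_cases ht₂ : ∫⁻ x, f₂ x ^ p₂ ∂ν₂ = ∞
  · rw [ht₂, ENNReal.top_rpow_of_pos (by positivity),
      ENNReal.mul_top (mul_ne_zero (mul_ne_zero hC hS) e₁)]
    exact le_top
  exact core_fin F hF hm m μ ν₁ ν₂ hfin₁ hfin₂ hm₁ hm₂ f₁ f₂ hf₁ hf₂ S hp₁ hp₂ hq₁ hq₂ test ht₁ ht₂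

end Core

lemma cube_meas {n : ℕ} (c : Rn n) (l : ℝ) : MeasurableSet (cube c l) := by
  have : cube c l = Set.pi univ (fun i => Ico (c i) (c i + l)) := by
    ext x; simp [cube]
  rw [this]
  exact MeasurableSet.univ_pi fun i => measurableSet_Ico

lemma cube_int {n : ℕ} (c : Rn n) {l : ℝ} (hl : 0 < l) : (interior (cube c l)).Nonempty := by
  refine ⟨fun i => c i + l / 2, ?_⟩
  rw [mem_interior]
  refine ⟨Set.pi univ (fun i => Ioo (c i) (c i + l)), ?_, isOpen_set_pi finite_univ
    (fun i _ => isOpen_Ioo), ?_⟩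
  · intro x hx i
    have := hx i (mem_univ i)
    exact ⟨this.1.le, this.2⟩
  · intro i _
    constructor <;> dsimp only <;> linarith

lemma cube_sub_eq {n : ℕ} {c c' : Rn n} {l : ℝ} (hl : 0 < l) (h : cube c l ⊆ cube c' l) :
    cube c l = cube c' l := by
  have h1 : c ∈ cube c' l := h fun i => ⟨le_rfl, by linarith⟩
  have : c = c' := by
    funext i
    by_contra hne
    have hlt : c' i < c i := lt_of_le_of_ne (h1 i).1 (Ne.symm hne)
    have h2 : Function.update c i (max (c i) (c' i + l)) ∈ cube c l := by
      intro j
      by_cases hj : j = i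
      · subst hj; simp [hl, hlt]
      · simp [hj, hl]
    have h3 := (h h2 i).2
    rw [Function.update_self] at h3
    exact absurd h3 (not_lt.2 (le_max_right _ _))
  rw [this]

lemma grid_nested {n : ℕ} {𝒟 : Set (Set (Rn n))} (h𝒟 : IsDyadicGrid 𝒟) {Q R : Set (Rn n)}
    (hQ : Q ∈ 𝒟) (hR : R ∈ 𝒟) : Q ⊆ R ∨ R ⊆ Q ∨ Disjoint Q R := by
  rcases h𝒟.2.1 Q hQ R hR with h | h | h
  · exact Or.inl (inter_eq_left.1 h)
  · exact Or.inr (Or.inl (inter_eq_right.1 h))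
  · exact Or.inr (Or.inr (disjoint_iff_inter_eq_empty.2 h))

lemma grid_countable {n : ℕ} {𝒟 : Set (Set (Rn n))} (h𝒟 : IsDyadicGrid 𝒟) : 𝒟.Countable := by
  have hc : ∀ k : ℤ, {Q | Q ∈ 𝒟 ∧ ∃ c : Rn n, Q = cube c ((2:ℝ) ^ k)}.Countable := by
    intro k
    have hpos : (0:ℝ) < 2 ^ k := by positivity
    refine Set.PairwiseDisjoint.countable_of_nonempty_interior (s := id) ?_ ?_
    · rintro Q ⟨hQ, c, hc⟩ R ⟨hR, c', hc'⟩ hne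
      rcases grid_nested h𝒟 hQ hR with h | h | h
      · refine absurd ?_ hne
        rw [hc, hc'] at h ⊢
        exact cube_sub_eq hpos h
      · refine absurd ?_ hne
        rw [hc, hc'] at h ⊢
        exact (cube_sub_eq hpos h).symm
      · exact h
    · rintro Q ⟨_, c, rfl⟩
      exact cube_int c hpos
  refine (Set.countable_iUnion hc).mono ?_
  intro Q hQ
  obtain ⟨c, k, h⟩ := h𝒟.1 Q hQ
  exact mem_iUnion.2 ⟨k, hQ, c, h⟩

lemma mul_av {X : Type*} [MeasurableSpace X] (ν : Measure X) (f : X → ℝ≥0∞) {Q : Set X}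
    (h : ν Q ≠ ∞) : ν Q * av ν f Q = ∫⁻ x in Q, f x ∂ν := by
  by_cases h0 : ν Q = 0
  · rw [h0, setLIntegral_measure_zero _ _ h0, zero_mul]
  · rw [av, ← mul_assoc, ENNReal.mul_inv_cancel h0 h, one_mul]

/-- Lemma 3.2: the Sawyer testing constant controls the full
dyadic bilinear fractional maximal operator. -/
theorem stmt11 (n : ℕ) (hn : 0 < n) (α p₁ p₂ p q : ℝ)
    (hα0 : 0 ≤ α) (hα : α < 2 * n) (hp₁ : 1 < p₁) (hp₂ : 1 < p₂)
    (hp : 1/p = 1/p₁ + 1/p₂) (hq : 1/q = 1/p - α/n)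
    (hqp₁ : p₁ ≤ q) (hqp₂ : p₂ ≤ q) :
    ∃ C : ℝ≥0∞, C ≠ ∞ ∧
      ∀ (w₁ w₂ v σ₁ σ₂ : Rn n → ℝ≥0∞),
        Measurable w₁ → Measurable w₂ → Measurable v →
        σ₁ = (fun x => w₁ x ^ (1 - p₁/(p₁-1))) →
        σ₂ = (fun x => w₂ x ^ (1 - p₂/(p₂-1))) →
        (∀ (c : Rn n) (l : ℝ), wtI σ₁ (cube c l) ≠ ∞) →
        (∀ (c : Rn n) (l : ℝ), wtI σ₂ (cube c l) ≠ ∞) →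
        (∀ (c : Rn n) (l : ℝ), wtI v (cube c l) ≠ ∞) →
        sawyer2 n α p₁ p₂ q σ₁ σ₂ v ≠ ∞ →
        ∀ (𝒟 : Set (Set (Rn n))), IsDyadicGrid 𝒟 →
        ∀ f₁ f₂ : Rn n → ℝ≥0∞, Measurable f₁ → Measurable f₂ →
          (∫⁻ x,
              M2D n α 𝒟 (fun y => f₁ y * σ₁ y) (fun y => f₂ y * σ₂ y) x ^ q * v x) ^ (1/q)
            ≤ C * sawyer2 n α p₁ p₂ q σ₁ σ₂ v *
                (∫⁻ x, f₁ x ^ p₁ * σ₁ x) ^ (1/p₁) * (∫⁻ x, f₂ x ^ p₂ * σ₂ x) ^ (1/p₂) := by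
  have hq0 : 0 < q := by linarith
  refine ⟨Cc p₁ p₂ q, Cc_ne_top hp₁ hp₂ hq0, ?_⟩
  intro w₁ w₂ v σ₁ σ₂ hw₁ hw₂ hv hσ₁ hσ₂ hf1 hf2 _ hS 𝒟 h𝒟 f₁ f₂ hf₁ hf₂
  have hm₁ : Measurable σ₁ := by rw [hσ₁]; exact hw₁.pow_const _
  have hm₂ : Measurable σ₂ := by rw [hσ₂]; exact hw₂.pow_const _
  clear hσ₁ hσ₂
  set S := sawyer2 n α p₁ p₂ q σ₁ σ₂ v with hSdef
  set ν₁ := (volume : Measure (Rn n)).withDensity σ₁ with hν₁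
  set ν₂ := (volume : Measure (Rn n)).withDensity σ₂ with hν₂
  set μ := (volume : Measure (Rn n)).withDensity v with hμ
  set a : ℝ := -(1 - α / (2 * (n : ℝ))) with ha
  have hDm : ∀ Q ∈ 𝒟, MeasurableSet Q := by
    intro Q hQ
    obtain ⟨c, k, rfl⟩ := h𝒟.1 Q hQ
    exact cube_meas _ _
  have hν₁Q : ∀ Q, MeasurableSet Q → ν₁ Q = ∫⁻ x in Q, σ₁ x := fun Q hQ => withDensity_apply _ hQ
  have hν₂Q : ∀ Q, MeasurableSet Q → ν₂ Q = ∫⁻ x in Q, σ₂ x := fun Q hQ => withDensity_apply _ hQ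
  have hfin₁ : ∀ Q ∈ 𝒟, ν₁ Q ≠ ∞ := by
    intro Q hQ
    rw [hν₁Q Q (hDm Q hQ)]
    obtain ⟨c, k, rfl⟩ := h𝒟.1 Q hQ
    exact hf1 _ _
  have hfin₂ : ∀ Q ∈ 𝒟, ν₂ Q ≠ ∞ := by
    intro Q hQ
    rw [hν₂Q Q (hDm Q hQ)]
    obtain ⟨c, k, rfl⟩ := h𝒟.1 Q hQ
    exact hf2 _ _
  set m : Set (Rn n) → ℝ≥0∞ := fun Q => (volume Q ^ a * ν₁ Q) * (volume Q ^ a * ν₂ Q) with hmdef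
  set t : Set (Rn n) → ℝ≥0∞ := fun Q => m Q * (av ν₁ f₁ Q * av ν₂ f₂ Q) with htdef
  have ht : ∀ Q ∈ 𝒟, (volume Q ^ a * ∫⁻ y in Q, f₁ y * σ₁ y) *
      (volume Q ^ a * ∫⁻ y in Q, f₂ y * σ₂ y) = t Q := by
    intro Q hQ
    have e₁ : ∫⁻ y in Q, f₁ y * σ₁ y = ν₁ Q * av ν₁ f₁ Q := by
      rw [mul_av ν₁ f₁ (hfin₁ Q hQ), hν₁,
        setLIntegral_withDensity_eq_setLIntegral_mul _ hm₁ hf₁ (hDm Q hQ)]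
      simp only [Pi.mul_apply, mul_comm]
    have e₂ : ∫⁻ y in Q, f₂ y * σ₂ y = ν₂ Q * av ν₂ f₂ Q := by
      rw [mul_av ν₂ f₂ (hfin₂ Q hQ), hν₂,
        setLIntegral_withDensity_eq_setLIntegral_mul _ hm₂ hf₂ (hDm Q hQ)]
      simp only [Pi.mul_apply, mul_comm]
    rw [e₁, e₂, htdef, hmdef]
    ring
  have hN₁ : ∫⁻ x, f₁ x ^ p₁ ∂ν₁ = ∫⁻ x, f₁ x ^ p₁ * σ₁ x := by
    rw [hν₁, lintegral_withDensity_eq_lintegral_mul _ hm₁ (hf₁.pow_const _)]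
    simp only [Pi.mul_apply, mul_comm]
  have hN₂ : ∫⁻ x, f₂ x ^ p₂ ∂ν₂ = ∫⁻ x, f₂ x ^ p₂ * σ₂ x := by
    rw [hν₂, lintegral_withDensity_eq_lintegral_mul _ hm₂ (hf₂.pow_const _)]
    simp only [Pi.mul_apply, mul_comm]
  -- the finite estimate
  have hfinite : ∀ F : Finset (Set (Rn n)), (∀ Q ∈ F, Q ∈ 𝒟) →
      (∫⁻ x, MF F t x ^ q ∂μ) ^ (1/q) ≤ Cc p₁ p₂ q * S *
        (∫⁻ x, f₁ x ^ p₁ * σ₁ x) ^ (1/p₁) * (∫⁻ x, f₂ x ^ p₂ * σ₂ x) ^ (1/p₂) := by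
    intro F hF
    rw [← hN₁, ← hN₂]
    refine core F (fun Q hQ R hR => grid_nested h𝒟 (hF Q hQ) (hF R hR))
      (fun Q hQ => hDm Q (hF Q hQ)) m μ ν₁ ν₂ (fun Q hQ => hfin₁ Q (hF Q hQ))
      (fun Q hQ => hfin₂ Q (hF Q hQ)) (fun Q _ h => by simp [hmdef, h])
      (fun Q _ h => by simp [hmdef, h]) f₁ f₂ hf₁ hf₂ S hp₁ hp₂ hqp₁ hqp₂ ?_
    intro G hG
    have hGm := hDm G (hF G hG)
    have h1 : ∫⁻ x in G, MG F m G x ^ q ∂μ ≤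
        ∫⁻ x in G, M2 n α (G.indicator σ₁) (G.indicator σ₂) x ^ q * v x := by
      rw [hμ, setLIntegral_withDensity_eq_setLIntegral_mul _ hv
        ((MG_meas F (fun Q hQ => hDm Q (hF Q hQ)) m G).pow_const q) hGm]
      refine lintegral_mono fun x => ?_
      simp only [Pi.mul_apply]
      rw [mul_comm]
      refine mul_le_mul_left (ENNReal.rpow_le_rpow ?_ hq0.le) _
      unfold MG
      refine iSup₂_le fun Q hQ => iSup_le fun hQG => ?_
      by_cases hx : x ∈ Q
      swap
      · simp [hx]
      rw [indicator_of_mem hx]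
      have hQm := hDm Q (hF Q hQ)
      have e : ∀ σ : Rn n → ℝ≥0∞, ∫⁻ y in Q, G.indicator σ y = ∫⁻ y in Q, σ y := by
        intro σ
        refine setLIntegral_congr_fun hQm fun y hy => ?_
        exact indicator_of_mem (hQG hy) σ
      have e2 : m Q = (volume Q ^ a * ∫⁻ y in Q, G.indicator σ₁ y) *
          (volume Q ^ a * ∫⁻ y in Q, G.indicator σ₂ y) := by
        rw [e, e, ← hν₁Q Q hQm, ← hν₂Q Q hQm]
      rw [e2]
      obtain ⟨c, k, rfl⟩ := h𝒟.1 Q (hF Q hQ)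
      unfold M2
      exact le_iSup₂_of_le c _ (le_iSup₂_of_le (by positivity) hx le_rfl)
    refine h1.trans ?_
    rw [← ENNReal.rpow_inv_le_iff hq0, ← one_div]
    have hb : ν₁ G ^ (1/p₁) * ν₂ G ^ (1/p₂) ≠ ∞ :=
      ENNReal.mul_ne_top (ENNReal.rpow_ne_top_of_nonneg (by positivity) (hfin₁ G (hF G hG)))
        (ENNReal.rpow_ne_top_of_nonneg (by positivity) (hfin₂ G (hF G hG)))
    rw [← ENNReal.div_le_iff_le_mul (Or.inr hS) (Or.inl hb), hν₁Q G hGm, hν₂Q G hGm]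
    obtain ⟨c, k, rfl⟩ := h𝒟.1 G (hF G hG)
    rw [hSdef]
    unfold sawyer2
    exact le_iSup₂_of_le c _ (le_iSup_of_le (by positivity) le_rfl)
  -- exhaustion
  classical
  have hne : 𝒟.Nonempty := by
    by_contra h
    rw [not_nonempty_iff_eq_empty] at h
    have h2 := h𝒟.2.2 0
    have h3 : (0 : Rn n) ∈ (univ : Set (Rn n)) := mem_univ _
    rw [← h2, h] at h3
    simp at h3
  obtain ⟨e, he⟩ := (grid_countable h𝒟).exists_eq_range hne
  set F : ℕ → Finset (Set (Rn n)) := fun N => (Finset.range N).image e with hFdef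
  have hFD : ∀ N, ∀ Q ∈ F N, Q ∈ 𝒟 := by
    intro N Q hQ
    obtain ⟨i, _, rfl⟩ := Finset.mem_image.1 hQ
    rw [he]; exact mem_range_self i
  have hmono : ∀ x, Monotone fun N => MF (F N) t x := by
    intro x N M hNM
    refine iSup₂_le fun Q hQ => ?_
    refine le_iSup₂_of_le (f := fun Q (_ : Q ∈ F M) => Q.indicator (fun _ => t Q) x) Q ?_ le_rfl
    exact Finset.image_subset_image (Finset.range_mono hNM) hQ
  have hMFm : ∀ N, Measurable (MF (F N) t) := by
    intro N
    unfold MF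
    exact Measurable.biSup (F N : Set (Set (Rn n))) (F N).countable_toSet
      (f := fun Q x => Q.indicator (fun _ => t Q) x)
      fun Q hQ => measurable_const.indicator (hDm Q (hFD N Q hQ))
  have hsup : ∀ x, M2D n α 𝒟 (fun y => f₁ y * σ₁ y) (fun y => f₂ y * σ₂ y) x ≤
      ⨆ N, MF (F N) t x := by
    intro x
    unfold M2D
    refine iSup₂_le fun Q hQ => iSup_le fun hx => ?_
    rw [← ha, ht Q hQ]
    have hQ' := hQ
    rw [he] at hQ'
    obtain ⟨i, rfl⟩ := hQ'
    refine le_iSup_of_le (i+1) ?_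
    refine le_iSup₂_of_le (f := fun Q (_ : Q ∈ F (i+1)) => Q.indicator (fun _ => t Q) x) (e i)
      (Finset.mem_image_of_mem e (by simp)) ?_
    rw [indicator_of_mem hx]
  have hsupq : ∀ x, (⨆ N, MF (F N) t x) ^ q = ⨆ N, MF (F N) t x ^ q := by
    intro x
    exact (ENNReal.orderIsoRpow q hq0).map_iSup (fun N => MF (F N) t x)
  rw [one_div, ENNReal.rpow_inv_le_iff hq0]
  calc _ ≤ ∫⁻ x, (⨆ N, MF (F N) t x ^ q) * v x := by
        refine lintegral_mono fun x => ?_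
        dsimp only
        rw [← hsupq]
        exact mul_le_mul_left (ENNReal.rpow_le_rpow (hsup x) hq0.le) _
    _ = ∫⁻ x, (⨆ N, MF (F N) t x ^ q) ∂μ := by
        rw [hμ, lintegral_withDensity_eq_lintegral_mul _ hv
          (Measurable.iSup fun N => (hMFm N).pow_const q)]
        simp only [Pi.mul_apply, mul_comm]
    _ = ⨆ N, ∫⁻ x, MF (F N) t x ^ q ∂μ := by
        rw [lintegral_iSup (fun N => (hMFm N).pow_const q)]
        intro N M hNM x
        exact ENNReal.rpow_le_rpow (hmono x hNM) hq0.le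
    _ ≤ _ := by
        refine iSup_le fun N => ?_
        rw [← ENNReal.rpow_inv_le_iff hq0, ← one_div]
        exact hfinite (F N) (hFD N)
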